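/- Fix n ≥ m ≥ 2, an integer k with 1 ≤ k ≤ n, a pair (M,N) ∈ 𝒞_{n,k}, and a tuple (x_1,…,x_{m−2}) ∈ 𝒯_M. Then the number of configurations β ∈ Ω = (ℤ/nℤ) → {0,1} satisfying β_1 = 1, N1(β) = k, N_{10^s1}(β) = x_s for each s ∈ {1,…,m−2}, and N_{0^{m−1}1}(β) = N, equals k!/(x_1!⋯x_{m−2}!·N!·(k−N−x_1−⋯−x_{m−2})!) · C(n−k−M−(m−2)N−1, N−1). -/

import Mathlib

open Finset

/-- Per-site transition factor `q_i(α, b)` of the m-NED: if the window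
`(α_i, …, α_{i+m-1})` is `0^m` the site becomes `1` with probability `p1`;
if it is `0^{m-1}1` it becomes `1` with probability `1 - p2`; otherwise it
becomes `0` with probability `1`. -/
noncomputable def nedQ (n m : ℕ) (p1 p2 : ℝ) (α : ZMod n → Bool) (i : ZMod n) (b : Bool) : ℝ :=
  if ∀ j : Fin m, α (i + (j.val : ZMod n)) = false then
    if b then p1 else 1 - p1
  else if (∀ j : Fin (m - 1), α (i + (j.val : ZMod n)) = false) ∧
      α (i + ((m - 1 : ℕ) : ZMod n)) = true then
    if b then 1 - p2 else p2
  else if b then 0 else 1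

/-- Transition probability `P(α → β)` of the m-NED on the ring of `n` sites. -/
noncomputable def nedP (n m : ℕ) [NeZero n] (p1 p2 : ℝ) (α β : ZMod n → Bool) : ℝ :=
  ∏ i : ZMod n, nedQ n m p1 p2 α i (β i)

/-- `N₁(β)`: the number of sites carrying the symbol `1`. -/
def nedN1 (n : ℕ) [NeZero n] (β : ZMod n → Bool) : ℕ :=
  (univ.filter fun i : ZMod n => β i = true).card

/-- `N_{10^r 1}(β)`: the number of occurrences of the subsequence `1 0^r 1`. -/
def nedN10r1 (n : ℕ) [NeZero n] (r : ℕ) (β : ZMod n → Bool) : ℕ :=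
  (univ.filter fun i : ZMod n =>
    β i = true ∧ (∀ j : Fin r, β (i + ((j.val + 1 : ℕ) : ZMod n)) = false) ∧
      β (i + ((r + 1 : ℕ) : ZMod n)) = true).card

/-- `N_{0^r 1}(β)`: the number of occurrences of the subsequence `0^r 1`. -/
def nedN0r1 (n : ℕ) [NeZero n] (r : ℕ) (β : ZMod n → Bool) : ℕ :=
  (univ.filter fun i : ZMod n =>
    (∀ j : Fin r, β (i + (j.val : ZMod n)) = false) ∧
      β (i + ((r : ℕ) : ZMod n)) = true).card

/-- The stationary weight
`W(β) = p1^{N₁(β)} (1-p1)^{∑_{r=1}^{m-2} r N_{10^r1}(β) + (m-1) N_{0^{m-1}1}(β)} p2^{-N_{0^{m-1}1}(β)}`. -/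
noncomputable def nedW (n m : ℕ) [NeZero n] (p1 p2 : ℝ) (β : ZMod n → Bool) : ℝ :=
  p1 ^ nedN1 n β *
    (1 - p1) ^ ((∑ r ∈ Finset.Icc 1 (m - 2), r * nedN10r1 n r β) +
      (m - 1) * nedN0r1 n (m - 1) β) / p2 ^ nedN0r1 n (m - 1) β

/-- The partition function `Z_{n,m} = ∑_{β ∈ Ω} W(β)`. -/
noncomputable def nedZ (n m : ℕ) [NeZero n] (p1 p2 : ℝ) : ℝ :=
  ∑ β : ZMod n → Bool, nedW n m p1 p2 β

/-- Integer binomial coefficient with the convention `C(-1,-1) = 1`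
(and value `0` when the lower index is otherwise negative). -/
def ichoose (a b : ℤ) : ℕ :=
  if a = -1 ∧ b = -1 then 1 else if 0 ≤ b then Nat.choose a.toNat b.toNat else 0

/-- The multinomial coefficient `k! / (x₁! ⋯ x_t! · N! · (k - N - ∑ x)!)`, written as the
product of successive binomial coefficients (hence `0` whenever `N + ∑ x > k`). -/
def multChain {t : ℕ} (k : ℕ) (x : Fin t → ℕ) (N : ℕ) : ℕ :=
  (∏ j : Fin t, Nat.choose (k - ∑ s ∈ univ.filter (fun s => s < j), x s) (x j)) *
    Nat.choose (k - ∑ s, x s) N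

/-- `𝒯_M`: the tuples `(x_1, …, x_{m-2}) ∈ {0,1,…,k}^{m-2}` with `∑_{s=1}^{m-2} s·x_s = M`. -/
def nedT (m k M : ℕ) : Finset (Fin (m - 2) → ℕ) :=
  (Fintype.piFinset fun _ : Fin (m - 2) => Finset.range (k + 1)).filter fun x =>
    ∑ s, (s.val + 1) * x s = M

/-- `𝒞_{n,k}`: the pairs `(M, N)` of nonnegative integers with
`M ∈ {0,…,n-k-m+1} ∪ {n-k}`, `(m-1)·N + M ≤ n-k`, and `N = 0 ↔ M = n-k`. -/
def nedC (n m k : ℕ) : Finset (ℕ × ℕ) :=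
  (Finset.range (n + 1) ×ˢ Finset.range (n + 1)).filter fun MN =>
    (MN.1 + (m - 1) ≤ n - k ∨ MN.1 = n - k) ∧
      MN.2 * (m - 1) + MN.1 ≤ n - k ∧ (MN.2 = 0 ↔ MN.1 = n - k)

/-- `|Pos_{a₁b₁,a₂b₂}|`: the number of sites `i` with `(α_i, α_{i+1}) = (a₁, b₁)` and
`(β_i, β_{i+1}) = (a₂, b₂)`. -/
def posCount (n : ℕ) [NeZero n] (α β : ZMod n → Bool) (a1 b1 a2 b2 : Bool) : ℕ :=
  (univ.filter fun i : ZMod n =>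
    α i = a1 ∧ α (i + 1) = b1 ∧ β i = a2 ∧ β (i + 1) = b2).card

/-- The explicit sequence `Z_0 = 2`,
`Z_n = 1 + ∑_{k=1}^n ∑_{j=0}^{n-k} (n/k)·C(k,j)·C(n-k-1,j-1)·p1^k·q2^j` for `n ≥ 1`,
with `q2 = (1-p1)/p2` and the convention `C(-1,-1) = 1`. -/
noncomputable def Zseq (p1 p2 : ℝ) (n : ℕ) : ℝ :=
  if n = 0 then 2
  else 1 + ∑ k ∈ Finset.Icc 1 n, ∑ j ∈ Finset.range (n - k + 1),
    (n : ℝ) / k * (Nat.choose k j : ℝ) * (ichoose ((n : ℤ) - k - 1) ((j : ℤ) - 1) : ℝ) *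
      p1 ^ k * ((1 - p1) / p2) ^ j

/-- The unnormalized density sequence `D_0 = 0`,
`D_n = ∑_{k=1}^n ∑_{j=0}^{n-k} C(k,j)·C(n-k-1,j-1)·p1^k·q2^j` for `n ≥ 1`. -/
noncomputable def Dseq (p1 p2 : ℝ) (n : ℕ) : ℝ :=
  if n = 0 then 0
  else ∑ k ∈ Finset.Icc 1 n, ∑ j ∈ Finset.range (n - k + 1),
    (Nat.choose k j : ℝ) * (ichoose ((n : ℤ) - k - 1) ((j : ℤ) - 1) : ℝ) *
      p1 ^ k * ((1 - p1) / p2) ^ j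

/-- The partition function of the 2-NED on a ring of `n ≥ 1` sites,
`Z_{n,2} = ∑_{β ∈ Ω} p1^{N₁(β)} ((1-p1)/p2)^{N_{01}(β)}` (with value `2` at `n = 0`). -/
noncomputable def Zpart2 (p1 p2 : ℝ) (n : ℕ) : ℝ :=
  if h : n = 0 then 2
  else
    haveI : NeZero n := ⟨h⟩
    ∑ β : ZMod n → Bool, p1 ^ nedN1 n β * ((1 - p1) / p2) ^ nedN0r1 n 1 β

theorem natCast_zmod_inj {n a b : ℕ} (h : (a : ZMod n) = b) (hab : a < b + n) (hba : b < a + n) :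
    a = b := by
  rw [ZMod.natCast_eq_natCast_iff] at h
  have hd := h.dvd
  have : ((b : ℤ) - a) = 0 := Int.eq_zero_of_abs_lt_dvd hd (by rw [abs_lt]; omega)
  omega

theorem card_filter_fin_eq_countP {k : ℕ} (g : Fin k → ℕ) (p : ℕ → Prop) [DecidablePred p] :
    #{j | p (g j)} = (List.ofFn g).countP (fun a => decide (p a)) := by
  induction k with
  | zero => simp
  | succ k ih =>
    rw [Fin.card_filter_univ_succ', List.ofFn_succ, List.countP_cons, add_comm, ih]
    simp

namespace Composition

variable {n : ℕ} (c : Composition n)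

theorem sizeUpTo_strictMonoOn : StrictMonoOn c.sizeUpTo (Set.Iic c.length) := by
  intro a _ b hb hab
  have ha' : a < c.length := lt_of_lt_of_le hab hb
  exact (c.sizeUpTo_strict_mono ha').trans_le (c.monotone_sizeUpTo hab)

theorem sizeUpTo_add_blocksFun (j : Fin c.length) :
    c.sizeUpTo j + c.blocksFun j = c.sizeUpTo (j + 1) := (c.sizeUpTo_succ' j).symm

/-- The configuration `β` on the ring, read from site `1` onwards, has its ones exactly at the
boundaries of the composition `c`. -/
def IsOnesOf (β : ZMod n → Bool) : Prop :=
  ∀ t ≤ n, β (1 + (t : ZMod n)) = true ↔ ∃ j ≤ c.length, c.sizeUpTo j = t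

variable {c} {β : ZMod n → Bool}

namespace IsOnesOf

theorem apply_sizeUpTo (h : c.IsOnesOf β) {j : ℕ} (hj : j ≤ c.length) :
    β (1 + (c.sizeUpTo j : ZMod n)) = true :=
  (h _ (c.sizeUpTo_le j)).2 ⟨j, hj, rfl⟩

theorem apply_eq_false (h : c.IsOnesOf β) {j t : ℕ} (h1 : c.sizeUpTo j < t)
    (h2 : t < c.sizeUpTo (j + 1)) : β (1 + (t : ZMod n)) = false := by
  rw [← Bool.not_eq_true, h t (h2.le.trans (c.sizeUpTo_le _))]
  rintro ⟨i, -, rfl⟩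
  have := c.monotone_sizeUpTo.reflect_lt h1
  have := c.monotone_sizeUpTo.reflect_lt h2
  omega

theorem card_filter_left [NeZero n] (h : c.IsOnesOf β) (Q : ZMod n → Prop) [DecidablePred Q] :
    #{i | β i = true ∧ Q i} = #{j : Fin c.length | Q (1 + (c.sizeUpTo j : ZMod n))} := by
  symm
  refine card_bij (fun j _ => 1 + (c.sizeUpTo j : ZMod n)) ?_ ?_ ?_
  · intro j hj
    simp only [mem_filter, mem_univ, true_and] at hj ⊢
    exact ⟨h.apply_sizeUpTo j.2.le, hj⟩
  · intro a _ b _ hab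
    have ha := c.sizeUpTo_strict_mono a.2
    have hb := c.sizeUpTo_strict_mono b.2
    have ha' := c.sizeUpTo_le (a + 1)
    have hb' := c.sizeUpTo_le (b + 1)
    have := natCast_zmod_inj (add_left_cancel hab) (by omega) (by omega)
    exact Fin.ext (c.sizeUpTo_strictMonoOn.injOn a.2.le b.2.le this)
  · intro i hi
    simp only [mem_filter, mem_univ, true_and] at hi
    have hi' : 1 + ((i - 1).val : ZMod n) = i := by simp
    have hlt := ZMod.val_lt (i - 1)
    obtain ⟨j, hj, hjt⟩ := (h (i - 1).val hlt.le).1 (by rw [hi']; exact hi.1)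
    have hjl : j < c.length := by
      refine lt_of_le_of_ne hj ?_
      rintro rfl
      rw [c.sizeUpTo_length] at hjt
      omega
    refine ⟨⟨j, hjl⟩, ?_, ?_⟩
    · simpa [hjt] using hi.2
    · simp [hjt]

theorem card_filter_right [NeZero n] (h : c.IsOnesOf β) (Q : ZMod n → Prop) [DecidablePred Q] :
    #{i | β i = true ∧ Q i} = #{j : Fin c.length | Q (1 + (c.sizeUpTo (j + 1) : ZMod n))} := by
  symm
  refine card_bij (fun j _ => 1 + (c.sizeUpTo (j + 1) : ZMod n)) ?_ ?_ ?_
  · intro j hj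
    simp only [mem_filter, mem_univ, true_and] at hj ⊢
    exact ⟨h.apply_sizeUpTo j.2, hj⟩
  · intro a _ b _ hab
    have ha := c.sizeUpTo_strict_mono a.2
    have hb := c.sizeUpTo_strict_mono b.2
    have ha' := c.sizeUpTo_le (a + 1)
    have hb' := c.sizeUpTo_le (b + 1)
    have := natCast_zmod_inj (add_left_cancel hab) (by omega) (by omega)
    have := c.sizeUpTo_strictMonoOn.injOn (Set.mem_Iic.2 a.2) (Set.mem_Iic.2 b.2) this
    exact Fin.ext (by omega)
  · intro i hi
    simp only [mem_filter, mem_univ, true_and] at hi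
    have hi' : 1 + (((i - 2).val + 1 : ℕ) : ZMod n) = i := by
      push_cast; rw [ZMod.natCast_zmod_val]; ring
    have hlt := ZMod.val_lt (i - 2)
    obtain ⟨j, hj, hjt⟩ := (h ((i - 2).val + 1) hlt).1 (by rw [hi']; exact hi.1)
    obtain _ | j := j
    · simp at hjt
    · refine ⟨⟨j, hj⟩, ?_, ?_⟩
      · simpa only [mem_filter, mem_univ, true_and, hjt, hi'] using hi.2
      · simp only [hjt, hi']

theorem nedN1_eq [NeZero n] (h : c.IsOnesOf β) : nedN1 n β = c.length := by
  simpa [nedN1] using h.card_filter_left (fun _ => True)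

theorem nedN10r1_eq [NeZero n] (h : c.IsOnesOf β) (r : ℕ) :
    nedN10r1 n r β = #{j | c.blocksFun j = r + 1} := by
  rw [nedN10r1, h.card_filter_left]
  congr 1
  refine filter_congr fun j _ => ?_
  have hb := c.sizeUpTo_add_blocksFun j
  have hb1 := c.one_le_blocksFun j
  simp only [add_assoc, ← Nat.cast_add]
  constructor
  · rintro ⟨h0, h1⟩
    rcases lt_trichotomy (c.blocksFun j) (r + 1) with hlt | heq | hgt
    · have h2 := h0 ⟨c.blocksFun j - 1, by omega⟩
      have h3 := h.apply_sizeUpTo j.2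
      rw [← hb] at h3
      simp only [Nat.sub_add_cancel hb1] at h2
      exact absurd (h2.symm.trans h3) Bool.false_ne_true
    · exact heq
    · have h2 := h.apply_eq_false (t := c.sizeUpTo j + (r + 1)) (j := j) (by omega) (by omega)
      exact absurd (h2.symm.trans h1) Bool.false_ne_true
  · intro hr
    refine ⟨fun d => h.apply_eq_false (j := j) (by omega) (by omega), ?_⟩
    rw [← hr, hb]
    exact h.apply_sizeUpTo j.2

theorem nedN0r1_eq [NeZero n] (h : c.IsOnesOf β) (r : ℕ) :
    nedN0r1 n r β = #{j | r + 1 ≤ c.blocksFun j} := by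
  have hshift : nedN0r1 n r β =
      #{i | β i = true ∧ ∀ d : Fin r, β (i - (r : ZMod n) + (d.val : ZMod n)) = false} := by
    refine card_equiv (Equiv.addRight (r : ZMod n)) fun i => ?_
    simp [and_comm]
  rw [hshift, h.card_filter_right]
  congr 1
  refine filter_congr fun j _ => ?_
  have hb := c.sizeUpTo_add_blocksFun j
  have hb1 := c.one_le_blocksFun j
  constructor
  · intro h0
    by_contra hlt
    have h2 := h0 ⟨r - c.blocksFun j, by omega⟩
    have h3 := h.apply_sizeUpTo j.2.le
    rw [← hb] at h2
    simp only [Nat.cast_sub (show c.blocksFun j ≤ r by omega), Nat.cast_add] at h2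
    rw [show (1 + ((c.sizeUpTo j : ZMod n) + c.blocksFun j) - r + (r - c.blocksFun j)) =
      1 + (c.sizeUpTo j : ZMod n) by ring, h3] at h2
    exact Bool.false_ne_true h2.symm
  · intro hr d
    have := h.apply_eq_false (t := c.sizeUpTo (j + 1) - r + d) (j := j) (by omega) (by omega)
    rw [Nat.cast_add, Nat.cast_sub (by omega)] at this
    rw [← this]
    congr 1
    ring

end IsOnesOf

theorem exists_isOnesOf [NeZero n] (hβ : β 1 = true) : ∃ c : Composition n, c.IsOnesOf β := by
  let B : CompositionAsSet n :=
    { boundaries := {t | β (1 + ((t : ℕ) : ZMod n)) = true}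
      zero_mem := by simpa using hβ
      getLast_mem := by simpa using hβ }
  refine ⟨B.toComposition, fun t ht => ?_⟩
  have h1 : β (1 + (t : ZMod n)) = true ↔ (⟨t, by omega⟩ : Fin (n + 1)) ∈ B.boundaries := by
    simp [B]
  rw [h1, ← B.toComposition_boundaries]
  simp only [boundaries, mem_map, mem_univ, true_and, boundary]
  constructor
  · rintro ⟨j, hj⟩
    exact ⟨j, by omega, by simpa [Fin.ext_iff] using hj⟩
  · rintro ⟨j, hj, hjt⟩
    exact ⟨⟨j, by omega⟩, by simpa [Fin.ext_iff] using hjt⟩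

variable (c) in
theorem exists_config_isOnesOf [NeZero n] : ∃ β : ZMod n → Bool, c.IsOnesOf β := by
  classical
  refine ⟨fun i => decide (∃ j < c.length, c.sizeUpTo j = (i - 1).val), fun t ht => ?_⟩
  have hn := Nat.pos_of_neZero n
  rw [decide_eq_true_iff, add_sub_cancel_left, ZMod.val_natCast]
  rcases ht.lt_or_eq with ht | rfl
  · rw [Nat.mod_eq_of_lt ht]
    refine exists_congr fun j => and_congr_left fun hj => ⟨le_of_lt, fun h => h.lt_of_ne ?_⟩
    rintro rfl
    simp at hj
    omega
  · simp only [Nat.mod_self]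
    exact ⟨fun _ => ⟨c.length, le_rfl, c.sizeUpTo_length⟩,
      fun _ => ⟨0, by simpa using hn, c.sizeUpTo_zero⟩⟩

theorem IsOnesOf.config_unique [NeZero n] {β' : ZMod n → Bool} (h : c.IsOnesOf β)
    (h' : c.IsOnesOf β') : β = β' := by
  funext i
  have hi : 1 + ((i - 1).val : ZMod n) = i := by simp
  rw [Bool.eq_iff_iff, ← hi, h _ (ZMod.val_lt _).le, h' _ (ZMod.val_lt _).le]

theorem IsOnesOf.composition_unique {c' : Composition n} (h : c.IsOnesOf β)
    (h' : c'.IsOnesOf β) : c = c' := by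
  have hb : ∀ c : Composition n, c.IsOnesOf β → ∀ t : Fin (n + 1),
      t ∈ c.boundaries ↔ β (1 + ((t : ℕ) : ZMod n)) = true := by
    intro c h t
    rw [h t (by omega)]
    simp only [boundaries, mem_map, mem_univ, true_and, boundary]
    constructor
    · rintro ⟨j, hj⟩
      exact ⟨j, by omega, by simpa [Fin.ext_iff] using hj⟩
    · rintro ⟨j, hj, hjt⟩
      exact ⟨⟨j, by omega⟩, by simpa [Fin.ext_iff] using hjt⟩
  apply (compositionEquiv n).injective
  apply CompositionAsSet.ext
  change c.boundaries = c'.boundaries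
  ext t
  rw [hb c h, hb c' h']

theorem IsOnesOf.apply_one (h : c.IsOnesOf β) : β 1 = true := by
  simpa using h.apply_sizeUpTo (Nat.zero_le _)

end Composition

open MvPolynomial in
theorem card_filter_fiber_card_eq {V : Type*} [Fintype V] [DecidableEq V] (k : ℕ) (y : V → ℕ)
    (hy : ∑ v, y v = k) :
    #{f : Fin k → V | ∀ v, #{j | f j = v} = y v} = Nat.multinomial univ y := by
  let d : V →₀ ℕ := Finsupp.equivFunOnFinite.symm y
  have h := coeff_sum_X_pow_of_fintype (R := ℕ) d k
  have hd : d.sum (fun _ m => m) = k := by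
    rw [Finsupp.sum_fintype _ _ (by simp)]
    simpa [d] using hy
  have hmono (f : Fin k → V) : ∏ j, (X (f j) : MvPolynomial V ℕ) =
      monomial (∑ j, Finsupp.single (f j) 1) 1 := by
    simp [X, monomial_sum_one]
  have hfib (f : Fin k → V) :
      ∑ j, Finsupp.single (f j) 1 = d ↔ ∀ v, #{j | f j = v} = y v := by
    rw [Finsupp.ext_iff]
    refine forall_congr' fun v => ?_
    simp [d, Finsupp.finsetSum_apply, Finsupp.single_apply]
  rw [if_pos hd, Fintype.sum_pow, coeff_sum] at h
  simp only [hmono, coeff_monomial, hfib] at h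
  rw [card_filter, h, Finsupp.multinomial_eq_of_support_subset (subset_univ _)]
  rfl

theorem card_piAntidiag_nat {ι : Type*} [Fintype ι] [DecidableEq ι] (s : Finset ι) (L : ℕ) :
    #(piAntidiag s L) = (#s).multichoose L := by
  rw [← card_finsuppAntidiag_nat_eq_multichoose]
  refine card_equiv Finsupp.equivFunOnFinite.symm fun f => ?_
  simp [mem_finsuppAntidiag, subset_iff]

theorem multChain_succ {t : ℕ} (k : ℕ) (x : Fin (t + 1) → ℕ) (N : ℕ) :
    multChain k x N = k.choose (x 0) * multChain (k - x 0) (fun s => x s.succ) N := by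
  have h0 : univ.filter (fun s : Fin (t + 1) => s < 0) = ∅ := by simp
  have hs (j : Fin t) : k - ∑ s with s < j.succ, x s =
      k - x 0 - ∑ s with s < j, x s.succ := by
    simp only [sum_filter, Fin.sum_univ_succ, Fin.succ_lt_succ_iff, Fin.succ_pos, if_true]
    rw [Nat.sub_sub]
  simp only [multChain, Fin.prod_univ_succ, h0, hs, sum_empty, Nat.sub_zero]
  rw [Fin.sum_univ_succ, Nat.sub_sub, mul_assoc]

theorem multChain_eq_zero {t : ℕ} {k : ℕ} {x : Fin t → ℕ} {N : ℕ} (h : k < N + ∑ s, x s) :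
    multChain k x N = 0 := by
  induction t generalizing k with
  | zero => simpa [multChain, Nat.choose_eq_zero_iff] using h
  | succ t ih =>
    rw [multChain_succ]
    rcases lt_or_ge k (x 0) with hk | hk
    · rw [Nat.choose_eq_zero_of_lt hk, zero_mul]
    · rw [Fin.sum_univ_succ] at h
      rw [ih (by omega), mul_zero]

open Nat in
theorem multChain_spec {t : ℕ} {k : ℕ} {x : Fin t → ℕ} {N : ℕ} (h : N + ∑ s, x s ≤ k) :
    (k - N - ∑ s, x s)! * ((∏ s, (x s)!) * N !) * multChain k x N = k ! := by
  induction t generalizing k with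
  | zero =>
    simp at h
    simp [multChain, ← Nat.choose_mul_factorial_mul_factorial h]
    ring
  | succ t ih =>
    rw [Fin.sum_univ_succ] at h
    have := ih (k := k - x 0) (x := fun s => x s.succ) (by omega)
    rw [multChain_succ, Fin.sum_univ_succ, Fin.prod_univ_succ,
      ← Nat.choose_mul_factorial_mul_factorial (show x 0 ≤ k by omega), ← this]
    rw [show k - N - (x 0 + ∑ s : Fin t, x s.succ) = k - x 0 - N - ∑ s : Fin t, x s.succ by omega]
    ring

theorem multinomial_univ_eq_multChain {t : ℕ} {k : ℕ} {x : Fin t → ℕ} {N : ℕ}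
    (h : N + ∑ s, x s ≤ k) :
    Nat.multinomial univ (Fin.cons (k - N - ∑ s, x s) (Fin.snoc x N : Fin (t + 1) → ℕ) :
      Fin (t + 2) → ℕ) = multChain k x N := by
  have h1 := Nat.multinomial_spec univ
    (Fin.cons (k - N - ∑ s, x s) (Fin.snoc x N : Fin (t + 1) → ℕ) : Fin (t + 2) → ℕ)
  have h2 := multChain_spec h
  simp only [Fin.prod_univ_succ, Fin.sum_univ_succ, Fin.cons_zero, Fin.cons_succ] at h1
  rw [← Fin.prod_univ_succ (fun i => ((Fin.snoc x N : Fin (t + 1) → ℕ) i).factorial),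
    ← Fin.sum_univ_succ (Fin.snoc x N : Fin (t + 1) → ℕ)] at h1
  simp only [Fin.prod_univ_castSucc, Fin.sum_univ_castSucc, Fin.snoc_castSucc, Fin.snoc_last] at h1
  rw [show k - N - ∑ s, x s + (∑ s, x s + N) = k by omega, ← h2] at h1
  refine Nat.eq_of_mul_eq_mul_left ?_ h1
  have := fun s => (x s).factorial_pos
  positivity

theorem sum_univ_fin_succ_castSucc {t : ℕ} (u : Fin (t + 2) → ℕ) :
    ∑ v, u v = u 0 + (∑ s : Fin t, u s.castSucc.succ + u (Fin.last (t + 1))) := by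
  rw [Fin.sum_univ_succ, Fin.sum_univ_castSucc, Fin.succ_last]

theorem card_filter_labelling {t : ℕ} (k : ℕ) (x : Fin t → ℕ) (N : ℕ) :
    #{f : Fin k → Fin (t + 2) | (∀ s : Fin t, #{j | f j = s.castSucc.succ} = x s) ∧
      #{j | f j = Fin.last (t + 1)} = N} = multChain k x N := by
  have hsum (f : Fin k → Fin (t + 2)) : ∑ v, #{j | f j = v} = k := by
    rw [← card_eq_sum_card_fiberwise (fun _ _ => mem_univ _), card_univ, Fintype.card_fin]
  simp only [sum_univ_fin_succ_castSucc] at hsum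
  rcases lt_or_ge k (N + ∑ s, x s) with h | h
  · rw [multChain_eq_zero h, card_eq_zero, filter_eq_empty_iff]
    rintro f - ⟨h1, h2⟩
    have := hsum f
    simp only [h1, h2] at this
    omega
  · rw [← multinomial_univ_eq_multChain h, ← card_filter_fiber_card_eq k]
    · refine congrArg card (Finset.ext fun f => ?_)
      simp only [mem_filter, mem_univ, true_and]
      have := hsum f
      constructor
      · rintro ⟨h1, h2⟩
        simp only [h1, h2] at this
        refine Fin.cases ?_ (Fin.lastCases ?_ fun s => ?_)
        · rw [Fin.cons_zero]; omega
        · rw [Fin.cons_succ, Fin.snoc_last, Fin.succ_last, h2]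
        · rw [Fin.cons_succ, Fin.snoc_castSucc, h1]
      · intro hf
        refine ⟨fun s => ?_, ?_⟩
        · rw [hf, Fin.cons_succ, Fin.snoc_castSucc]
        · rw [hf, ← Fin.succ_last, Fin.cons_succ, Fin.snoc_last]
    · rw [sum_univ_fin_succ_castSucc, ← Fin.succ_last]
      simp only [Fin.cons_zero, Fin.cons_succ, Fin.snoc_castSucc, Fin.snoc_last]
      omega

/-- The label of a gap: its size, with all sizes above `t` identified. -/
def gapLabel (t a : ℕ) : Fin (t + 2) := ⟨min a (t + 1), by omega⟩

theorem card_gapLabel_fiber {t k : ℕ} (f : Fin k → Fin (t + 2)) {S : ℕ}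
    (hS : ∑ j, (f j).val ≤ S) :
    #{g ∈ piAntidiag univ S | ∀ j, gapLabel t (g j) = f j} =
      (#{j | f j = Fin.last (t + 1)}).multichoose (S - ∑ j, (f j).val) := by
  rw [← card_piAntidiag_nat]
  symm
  refine card_bij (fun h _ j => (f j).val + h j) ?_ ?_ ?_
  · intro h hh
    simp only [mem_piAntidiag, mem_filter, mem_univ, true_and, implies_true, and_true] at hh ⊢
    have hsupp : ∑ j, h j = S - ∑ j, (f j).val := by
      rw [← hh.1]
      exact (sum_subset (subset_univ _) fun j _ hj => by
        by_contra h0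
        exact hj (by simpa using hh.2 j h0)).symm
    refine ⟨by rw [sum_add_distrib, hsupp]; omega, fun j => ?_⟩
    have := hh.2 j
    simp only [gapLabel, Fin.ext_iff, Fin.val_last] at this ⊢
    omega
  · intro a _ b _ hab
    funext j
    have := congrFun hab j
    simpa using this
  · intro g hg
    simp only [mem_piAntidiag, mem_filter, mem_univ, implies_true, and_true] at hg
    have hle (j : Fin k) : (f j).val ≤ g j := by
      rw [← hg.2 j]
      simp [gapLabel]
    have h0 (j : Fin k) (hj : g j - (f j).val ≠ 0) : f j = Fin.last (t + 1) := by
      have := congrArg Fin.val (hg.2 j)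
      simp only [gapLabel] at this
      rw [Fin.ext_iff, Fin.val_last]
      omega
    refine ⟨fun j => g j - (f j).val, ?_, ?_⟩
    · simp only [mem_piAntidiag, mem_filter, mem_univ, true_and]
      refine ⟨?_, h0⟩
      rw [sum_subset (subset_univ _) fun j _ hj => by
        by_contra h1
        exact hj (by simpa using h0 j h1)]
      rw [← hg.1, sum_tsub_distrib _ fun j _ => hle j]
    · funext j
      exact Nat.add_sub_cancel' (hle j)

theorem card_gaps {t : ℕ} (k S : ℕ) (x : Fin t → ℕ) (N : ℕ)
    (hS : ∑ s : Fin t, (s.val + 1) * x s + (t + 1) * N ≤ S) :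
    #{g ∈ piAntidiag (univ : Finset (Fin k)) S |
      (∀ s : Fin t, #{j | g j = s.val + 1} = x s) ∧ #{j | t + 1 ≤ g j} = N} =
      multChain k x N * N.multichoose (S - (∑ s : Fin t, (s.val + 1) * x s + (t + 1) * N)) := by
  have hsmall (a : ℕ) (s : Fin t) : a = s.val + 1 ↔ gapLabel t a = s.castSucc.succ := by
    simp only [gapLabel, Fin.ext_iff, Fin.val_succ, Fin.val_castSucc]
    omega
  have hlarge (a : ℕ) : t + 1 ≤ a ↔ gapLabel t a = Fin.last (t + 1) := by
    simp [gapLabel, Fin.ext_iff]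
  simp only [hsmall, hlarge]
  rw [← card_filter_labelling k x N,
    card_eq_sum_card_fiberwise (f := fun g j => gapLabel t (g j))
      (t := {f : Fin k → Fin (t + 2) | (∀ s : Fin t, #{j | f j = s.castSucc.succ} = x s) ∧
        #{j | f j = Fin.last (t + 1)} = N})]
  · rw [← smul_eq_mul, ← sum_const]
    refine sum_congr rfl fun f hf => ?_
    simp only [mem_filter, mem_univ, true_and] at hf
    have hval : ∑ j, (f j).val = ∑ s : Fin t, (s.val + 1) * x s + (t + 1) * N := by
      have : ∑ j, (f j).val = ∑ v : Fin (t + 2), v.val * #{j | f j = v} := by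
        rw [← sum_fiberwise univ f]
        refine sum_congr rfl fun v _ => ?_
        rw [sum_congr rfl (g := fun _ => v.val) (by simp +contextual), sum_const, smul_eq_mul,
          mul_comm]
      rw [this, sum_univ_fin_succ_castSucc]
      simp [hf.1, hf.2]
    rw [← hval, ← hf.2, ← card_gapLabel_fiber f (by omega), filter_filter]
    congr 1
    refine filter_congr fun g _ => ?_
    rw [funext_iff]
    refine ⟨fun h => h.2, fun h => ⟨?_, h⟩⟩
    simp only [h]
    exact ⟨hf.1, trivial⟩
  · intro g hg
    simpa using (mem_filter.1 hg).2

theorem multichoose_eq_ichoose (N L : ℕ) (h : N = 0 → L = 0) :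
    N.multichoose L = ichoose ((N : ℤ) + L - 1) ((N : ℤ) - 1) := by
  obtain _ | N := N
  · simp [h rfl, ichoose]
  · rw [Nat.multichoose_eq, ichoose, if_neg (by omega), if_pos (by omega)]
    rw [show (((N + 1 : ℕ) : ℤ) + L - 1).toNat = N + L by omega,
      show (((N + 1 : ℕ) : ℤ) - 1).toNat = N by omega, show N + 1 + L - 1 = N + L by omega,
      Nat.choose_symm_add]

/-- The composition with block sizes one more than the given gap sizes. -/
def compositionOfGaps {n k : ℕ} (g : Fin k → ℕ) (h : ∑ j, (g j + 1) = n) : Composition n where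
  blocks := List.ofFn fun j => g j + 1
  blocks_pos := by
    intro i hi
    obtain ⟨j, rfl⟩ := (List.mem_ofFn' _ _).1 hi
    exact Nat.succ_pos _
  blocks_sum := by rw [List.sum_ofFn, h]

theorem Composition.card_filter_blocksFun {n : ℕ} (c : Composition n) (p : ℕ → Prop)
    [DecidablePred p] : #{j | p (c.blocksFun j)} = c.blocks.countP (fun a => decide (p a)) := by
  rw [card_filter_fin_eq_countP, c.ofFn_blocksFun]

theorem card_config_eq_card_gaps {n : ℕ} [NeZero n] {t k : ℕ} (hkn : k ≤ n)
    (x : Fin t → ℕ) (N : ℕ) :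
    #{β : ZMod n → Bool | β 1 = true ∧ nedN1 n β = k ∧
      (∀ s : Fin t, nedN10r1 n (s.val + 1) β = x s) ∧ nedN0r1 n (t + 1) β = N} =
    #{g ∈ piAntidiag (univ : Finset (Fin k)) (n - k) |
      (∀ s : Fin t, #{j | g j = s.val + 1} = x s) ∧ #{j | t + 1 ≤ g j} = N} := by
  have hsum (g : Fin k → ℕ) : ∑ j, (g j + 1) = n ↔ ∑ j, g j = n - k := by
    rw [sum_add_distrib]
    simp
    omega
  have hlen (g : Fin k → ℕ) (h : ∑ j, (g j + 1) = n) : (compositionOfGaps g h).length = k := by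
    simp [compositionOfGaps, Composition.length]
  have hcount (g : Fin k → ℕ) (h : ∑ j, (g j + 1) = n) (p : ℕ → Prop) [DecidablePred p] :
      #{j | p ((compositionOfGaps g h).blocksFun j)} = #{j | p (g j + 1)} := by
    rw [Composition.card_filter_blocksFun, compositionOfGaps, ← card_filter_fin_eq_countP]
  have key (g : Fin k → ℕ) (h : ∑ j, (g j + 1) = n) (β : ZMod n → Bool)
      (hβ : (compositionOfGaps g h).IsOnesOf β) :
      (β 1 = true ∧ nedN1 n β = k ∧ (∀ s : Fin t, nedN10r1 n (s.val + 1) β = x s) ∧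
        nedN0r1 n (t + 1) β = N) ↔
      (∀ s : Fin t, #{j | g j = s.val + 1} = x s) ∧ #{j | t + 1 ≤ g j} = N := by
    simp only [hβ.apply_one, hβ.nedN1_eq, hlen, hβ.nedN10r1_eq, hβ.nedN0r1_eq, true_and,
      fun s : Fin t => hcount g h (fun a => a = s.val + 1 + 1),
      hcount g h (fun a => t + 1 + 1 ≤ a), Nat.add_right_cancel_iff, Nat.add_le_add_iff_right]
  choose B hB using fun c : Composition n => c.exists_config_isOnesOf
  symm
  refine card_bij (fun g hg => B (compositionOfGaps g
    ((hsum g).2 (mem_piAntidiag.1 (mem_filter.1 hg).1).1))) ?_ ?_ ?_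
  · intro g hg
    rw [mem_filter]
    exact ⟨mem_univ _, (key g _ _ (hB _)).2 (mem_filter.1 hg).2⟩
  · intro a ha b hb hab
    have ha' := hB (compositionOfGaps a ((hsum a).2 (mem_piAntidiag.1 (mem_filter.1 ha).1).1))
    have hb' := hB (compositionOfGaps b ((hsum b).2 (mem_piAntidiag.1 (mem_filter.1 hb).1).1))
    have h := ha'.composition_unique (hab ▸ hb')
    have h' := List.ofFn_injective (congrArg Composition.blocks h)
    funext j
    simpa using congrFun h' j
  · intro β hβ
    have hβ' := (mem_filter.1 hβ).2
    obtain ⟨c, hc⟩ := Composition.exists_isOnesOf hβ'.1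
    obtain rfl : c.length = k := hc.nedN1_eq ▸ hβ'.2.1
    have hpos (j : Fin c.length) : c.blocksFun j - 1 + 1 = c.blocksFun j :=
      Nat.sub_add_cancel (c.one_le_blocksFun j)
    have hn : ∑ j, (c.blocksFun j - 1 + 1) = n := by
      simp only [hpos, c.sum_blocksFun]
    have hcg : compositionOfGaps (fun j => c.blocksFun j - 1) hn = c := by
      apply Composition.ext
      simp only [compositionOfGaps, hpos, c.ofFn_blocksFun]
    refine ⟨fun j => c.blocksFun j - 1, ?_, ?_⟩
    · rw [mem_filter, mem_piAntidiag]
      exact ⟨⟨(hsum _).1 hn, fun _ _ => mem_univ _⟩, (key _ hn β (by rw [hcg]; exact hc)).1 hβ'⟩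
    · refine (hB _).config_unique ?_
      rw [hcg]
      exact hc

/-- the number of configurations `β` on the ring with `β₁ = 1`,
`N₁(β) = k`, `N_{10^s1}(β) = x_s` for each `s ∈ {1,…,m-2}` and `N_{0^{m-1}1}(β) = N`
equals `k!/(x₁!⋯x_{m-2}!·N!·(k-N-∑x)!) · C(n-k-M-(m-2)N-1, N-1)`. -/
theorem ned_configuration_count_marked (n m : ℕ) [NeZero n] (hm : 2 ≤ m) (hmn : m ≤ n)
    (k : ℕ) (hk1 : 1 ≤ k) (hkn : k ≤ n) (M N : ℕ) (hMN : (M, N) ∈ nedC n m k)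
    (x : Fin (m - 2) → ℕ) (hx : x ∈ nedT m k M) :
    (univ.filter fun β : ZMod n → Bool =>
        β 1 = true ∧ nedN1 n β = k ∧
          (∀ s : Fin (m - 2), nedN10r1 n (s.val + 1) β = x s) ∧
          nedN0r1 n (m - 1) β = N).card =
      multChain k x N * ichoose ((n : ℤ) - k - M - ((m : ℤ) - 2) * N - 1) ((N : ℤ) - 1) := by
  obtain ⟨t, rfl⟩ := Nat.exists_eq_add_of_le' hm
  simp only [nedC, nedT, mem_filter, mem_product, mem_range] at hMN hx
  obtain ⟨-, -, hle, hiff⟩ := hMN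
  have hxM : ∑ s : Fin t, (s.val + 1) * x s = M := hx.2
  have hle' : M + (t + 1) * N ≤ n - k := by
    rw [add_comm, mul_comm]
    exact hle
  have hgaps := card_gaps k (n - k) x N (t := t) (hxM ▸ hle')
  rw [hxM, multichoose_eq_ichoose _ _ fun hN => by rw [hiff.1 hN]; omega] at hgaps
  refine ((card_config_eq_card_gaps hkn x N).trans hgaps).trans ?_
  congr 2
  push_cast [Nat.cast_sub hle', Nat.cast_sub hkn]
  ring
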